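/- Let θ : ℚ_p → ℝ be a test function with ∫_{ℚ_p} θ dμ = 0. Then f₁ ⋆ θ is again a test function (it is locally constant and has compact support) and ∫_{ℚ_p} (f₁ ⋆ θ) dμ = 0. (That is, the inverse Vladimirov operator maps the real Lizorkin space of test functions of the second kind into itself.) -/

import Mathlib

open MeasureTheory

/-- A (Bruhat–Schwartz) test function on `ℚ_[p]`: locally constant with compact support. -/
def IsTestFunction {p : ℕ} [Fact p.Prime] (φ : ℚ_[p] → ℝ) : Prop :=
  (∀ x : ℚ_[p], ∃ l : ℤ, ∀ x' : ℚ_[p], ‖x'‖ ≤ (p : ℝ) ^ (-l) → φ (x + x') = φ x) ∧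
  HasCompactSupport φ

/-- `(f₁ ⋆ g)(x) = −((p−1)/(p ln p)) ∫ ln|x − y|_p g(y) dμ(y)`. -/
noncomputable def f1conv (p : ℕ) [Fact p.Prime] [MeasurableSpace ℚ_[p]]
    (μ : Measure ℚ_[p]) (g : ℚ_[p] → ℝ) (x : ℚ_[p]) : ℝ :=
  -(((p : ℝ) - 1) / ((p : ℝ) * Real.log p)) * ∫ y, Real.log ‖x - y‖ * g y ∂μ

section PadicLog

variable {p : ℕ} [Fact p.Prime]

theorem IsTestFunction.continuous {φ : ℚ_[p] → ℝ} (hφ : IsTestFunction φ) : Continuous φ := by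
  have hp : (0 : ℝ) < p := mod_cast (Fact.out : p.Prime).pos
  refine continuous_iff_continuousAt.2 fun x => ?_
  obtain ⟨l, hl⟩ := hφ.1 x
  have h : φ =ᶠ[nhds x] fun _ => φ x := by
    filter_upwards [Metric.ball_mem_nhds x (zpow_pos hp (-l))] with y hy
    have := hl (y - x) (by rw [← dist_eq_norm]; exact (Metric.mem_ball.1 hy).le)
    rwa [add_sub_cancel] at this
  exact (continuousAt_congr h).2 continuousAt_const

theorem IsTestFunction.exists_forall_add_eq {φ : ℚ_[p] → ℝ} (hφ : IsTestFunction φ) :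
    ∃ l : ℤ, ∀ x x' : ℚ_[p], ‖x'‖ ≤ (p : ℝ) ^ (-l) → φ (x + x') = φ x := by
  have hp : (1 : ℝ) < p := mod_cast (Fact.out : p.Prime).one_lt
  have hp0 : (0 : ℝ) < p := zero_lt_one.trans hp
  have hloc : IsLocallyConstant φ := by
    refine (IsLocallyConstant.iff_eventually_eq φ).2 fun x => ?_
    obtain ⟨l, hl⟩ := hφ.1 x
    filter_upwards [Metric.ball_mem_nhds x (zpow_pos hp0 (-l))] with y hy
    have := hl (y - x) (by rw [← dist_eq_norm]; exact (Metric.mem_ball.1 hy).le)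
    rwa [add_sub_cancel] at this
  obtain ⟨δ, hδ, h⟩ := lebesgue_number_lemma_of_metric (c := fun r : ℝ => φ ⁻¹' {r})
    hφ.2.isCompact (fun r => hloc.isOpen_fiber r) (fun x _ => by simp)
  obtain ⟨n, hn⟩ := exists_pow_lt_of_lt_one hδ (inv_lt_one_of_one_lt₀ hp)
  have key : ∀ x ∈ tsupport φ, ∀ x' : ℚ_[p], ‖x'‖ < δ → φ (x + x') = φ x := by
    intro x hx x' hx'
    obtain ⟨r, hr⟩ := h x hx
    have h1 : φ x = r := hr (Metric.mem_ball_self hδ)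
    have h2 : φ (x + x') = r := hr (by simpa [Metric.mem_ball, dist_eq_norm] using hx')
    rw [h1, h2]
  refine ⟨n, fun x x' hx' => ?_⟩
  have hlt : ‖x'‖ < δ := by
    refine hx'.trans_lt ?_
    simpa using hn
  by_cases hx : x ∈ tsupport φ
  · exact key x hx x' hlt
  by_cases hxx : x + x' ∈ tsupport φ
  · simpa using (key (x + x') hxx (-x') (by simpa using hlt)).symm
  · rw [image_eq_zero_of_notMem_tsupport hx, image_eq_zero_of_notMem_tsupport hxx]

theorem sub_mem_closedBall_zero_iff {x y : ℚ_[p]} {R : ℝ} (hy : y ∈ Metric.closedBall 0 R) :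
    x - y ∈ Metric.closedBall 0 R ↔ x ∈ Metric.closedBall 0 R := by
  simp only [mem_closedBall_zero_iff] at *
  constructor
  · intro h
    simpa using (Padic.nonarchimedean (x - y) y).trans (max_le h hy)
  · intro h
    have := (Padic.nonarchimedean x (-y)).trans (max_le h (by simpa using hy))
    rwa [← sub_eq_add_neg] at this

theorem enorm_log_norm_le_tsum {x : ℚ_[p]} (hx : ‖x‖ ≤ 1) :
    ‖Real.log ‖x‖‖ₑ ≤ ‖Real.log p‖ₑ *
      ∑' n : ℕ, (Metric.closedBall (0 : ℚ_[p]) ((p : ℝ)⁻¹ ^ n)).indicator 1 x := by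
  have hp : (1 : ℝ) < p := mod_cast (Fact.out : p.Prime).one_lt
  rcases eq_or_ne x 0 with rfl | hx0
  · simp
  obtain ⟨k, hk⟩ : ∃ k : ℕ, ‖x‖ = (p : ℝ)⁻¹ ^ k := by
    obtain ⟨k, hk⟩ := Int.eq_ofNat_of_zero_le ((Padic.norm_le_one_iff_val_nonneg x).1 hx)
    exact ⟨k, by rw [Padic.norm_eq_zpow_neg_valuation hx0, hk]; simp⟩
  have hlog : ‖Real.log ‖x‖‖ₑ = ‖Real.log p‖ₑ * k := by
    rw [hk, Real.log_pow, Real.log_inv, enorm_mul, enorm_neg, mul_comm]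
    congr 1
    simp
  rw [hlog]
  gcongr
  calc (k : ENNReal) = ∑ n ∈ Finset.range k,
        (Metric.closedBall (0 : ℚ_[p]) ((p : ℝ)⁻¹ ^ n)).indicator 1 x := by
        rw [Finset.sum_congr rfl (g := fun _ => 1)]
        · simp
        · intro n hn
          refine Set.indicator_of_mem ?_ _
          rw [mem_closedBall_zero_iff, hk]
          exact pow_le_pow_of_le_one (by positivity) (inv_le_one_of_one_le₀ hp.le)
            (Finset.mem_range.1 hn).le
    _ ≤ _ := ENNReal.sum_le_tsum _

theorem enorm_log_norm_le {x : ℚ_[p]} {R : ℝ} (hx : ‖x‖ ≤ R) :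
    ‖Real.log ‖x‖‖ₑ ≤ ‖Real.log R‖ₑ + ‖Real.log p‖ₑ *
      ∑' n : ℕ, (Metric.closedBall (0 : ℚ_[p]) ((p : ℝ)⁻¹ ^ n)).indicator 1 x := by
  rcases le_total ‖x‖ 1 with h | h
  · exact (enorm_log_norm_le_tsum h).trans le_add_self
  · refine le_trans ?_ le_self_add
    have h1 : Real.log ‖x‖ ≤ Real.log R := Real.log_le_log (by linarith) hx
    rw [enorm_le_iff_norm_le, Real.norm_of_nonneg (Real.log_nonneg h),
      Real.norm_of_nonneg (Real.log_nonneg (h.trans hx))]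
    exact h1

theorem indicator_closedBall_comp_sub {y : ℚ_[p]} {R : ℝ} (hy : y ∈ Metric.closedBall 0 R)
    (g : ℚ_[p] → ℝ) :
    (Metric.closedBall 0 R).indicator (fun x => g (x - y)) =
      fun x => (Metric.closedBall 0 R).indicator g (x - y) := by
  ext x
  by_cases hx : x ∈ Metric.closedBall 0 R
  · rw [Set.indicator_of_mem hx, Set.indicator_of_mem ((sub_mem_closedBall_zero_iff hy).2 hx)]
  · rw [Set.indicator_of_notMem hx,
      Set.indicator_of_notMem (mt (sub_mem_closedBall_zero_iff hy).1 hx)]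

theorem f1conv_eq_zero_of_lt_norm [MeasurableSpace ℚ_[p]] (μ : Measure ℚ_[p])
    {θ : ℚ_[p] → ℝ} {R : ℝ} (hR : ∀ y, R < ‖y‖ → θ y = 0)
    (hθ0 : ∫ x, θ x ∂μ = 0) {x : ℚ_[p]} (hx : R < ‖x‖) : f1conv p μ θ x = 0 := by
  have h : ∀ y, Real.log ‖x - y‖ * θ y = Real.log ‖x‖ * θ y := by
    intro y
    rcases lt_or_ge R ‖y‖ with hy | hy
    · simp [hR y hy]
    · rw [sub_eq_add_neg, Padic.add_eq_max_of_ne (by rw [norm_neg]; exact (hy.trans_lt hx).ne'),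
        norm_neg, max_eq_left (hy.trans hx.le)]
  simp [f1conv, h, integral_const_mul, hθ0]

variable [MeasurableSpace ℚ_[p]] [BorelSpace ℚ_[p]] (μ : Measure ℚ_[p]) [μ.IsAddHaarMeasure]

theorem two_mul_measure_closedBall_le (n : ℕ) :
    2 * μ (Metric.closedBall 0 ((p : ℝ)⁻¹ ^ (n + 1))) ≤
      μ (Metric.closedBall 0 ((p : ℝ)⁻¹ ^ n)) := by
  have hp : (1 : ℝ) < p := mod_cast (Fact.out : p.Prime).one_lt
  have hlt : (p : ℝ)⁻¹ ^ (n + 1) < (p : ℝ)⁻¹ ^ n :=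
    pow_lt_pow_right_of_lt_one₀ (by positivity) (inv_lt_one_of_one_lt₀ hp) n.lt_succ_self
  have hnorm : ‖(p : ℚ_[p]) ^ n‖ = (p : ℝ)⁻¹ ^ n := by simp
  set S := Metric.closedBall (0 : ℚ_[p]) ((p : ℝ)⁻¹ ^ (n + 1))
  set T := (fun x => x - (p : ℚ_[p]) ^ n) ⁻¹' S
  have hT : μ T = μ S := by
    simp only [T, sub_eq_add_neg]
    exact measure_preimage_add_right μ _ S
  have hTm : MeasurableSet T :=
    (Metric.isClosed_closedBall.preimage (by fun_prop)).measurableSet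
  have hdisj : Disjoint S T := by
    refine Set.disjoint_left.2 fun x hx hxT => ?_
    have hmem : x - (p : ℚ_[p]) ^ n ∈ S := hxT
    have h := (sub_mem_closedBall_zero_iff hmem).2 hx
    rw [sub_sub_cancel, mem_closedBall_zero_iff, hnorm] at h
    exact absurd h (not_le.2 hlt)
  rw [two_mul]
  nth_rewrite 2 [← hT]
  rw [← measure_union hdisj hTm]
  refine measure_mono (Set.union_subset (Metric.closedBall_subset_closedBall hlt.le) ?_)
  intro x hx
  have hx' : x - (p : ℚ_[p]) ^ n ∈ S := hx
  exact (sub_mem_closedBall_zero_iff (by rw [mem_closedBall_zero_iff, hnorm])).1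
    (Metric.closedBall_subset_closedBall hlt.le hx')

theorem measure_closedBall_le (n : ℕ) :
    μ (Metric.closedBall 0 ((p : ℝ)⁻¹ ^ n)) ≤ 2⁻¹ ^ n * μ (Metric.closedBall 0 1) := by
  induction n with
  | zero => simp
  | succ n ih =>
    have h := (two_mul_measure_closedBall_le μ n).trans ih
    calc μ (Metric.closedBall 0 ((p : ℝ)⁻¹ ^ (n + 1)))
        = 2⁻¹ * (2 * μ (Metric.closedBall 0 ((p : ℝ)⁻¹ ^ (n + 1)))) := by
          rw [← mul_assoc, ENNReal.inv_mul_cancel (by simp) (by simp), one_mul]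
      _ ≤ 2⁻¹ * (2⁻¹ ^ n * μ (Metric.closedBall 0 1)) := by gcongr
      _ = _ := by rw [← mul_assoc, pow_succ']

theorem integrableOn_log_norm (R : ℝ) :
    IntegrableOn (fun x : ℚ_[p] => Real.log ‖x‖) (Metric.closedBall 0 R) μ := by
  refine ⟨(Real.measurable_log.comp measurable_norm).aestronglyMeasurable, ?_⟩
  have hball : μ (Metric.closedBall (0 : ℚ_[p]) R) < ⊤ :=
    (isCompact_closedBall 0 R).measure_lt_top
  have hm : ∀ n : ℕ, Measurable
      ((Metric.closedBall (0 : ℚ_[p]) ((p : ℝ)⁻¹ ^ n)).indicator (1 : ℚ_[p] → ENNReal)) :=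
    fun n => measurable_one.indicator Metric.isClosed_closedBall.measurableSet
  have hsum : ∑' n : ℕ, μ (Metric.closedBall (0 : ℚ_[p]) ((p : ℝ)⁻¹ ^ n)) < ⊤ := by
    refine (ENNReal.tsum_le_tsum (measure_closedBall_le μ)).trans_lt ?_
    rw [ENNReal.tsum_mul_right, ENNReal.tsum_geometric]
    refine ENNReal.mul_lt_top ?_ (isCompact_closedBall 0 1).measure_lt_top
    simp [ENNReal.one_sub_inv_two]
  calc ∫⁻ x in Metric.closedBall (0 : ℚ_[p]) R, ‖Real.log ‖x‖‖ₑ ∂μ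
      ≤ ∫⁻ x in Metric.closedBall (0 : ℚ_[p]) R, (‖Real.log R‖ₑ + ‖Real.log p‖ₑ *
        ∑' n : ℕ, (Metric.closedBall (0 : ℚ_[p]) ((p : ℝ)⁻¹ ^ n)).indicator 1 x) ∂μ :=
        setLIntegral_mono' Metric.isClosed_closedBall.measurableSet fun x hx =>
          enorm_log_norm_le (mem_closedBall_zero_iff.1 hx)
    _ = ‖Real.log R‖ₑ * μ (Metric.closedBall (0 : ℚ_[p]) R) + ‖Real.log p‖ₑ *
        ∑' n : ℕ, ∫⁻ x in Metric.closedBall (0 : ℚ_[p]) R,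
          (Metric.closedBall (0 : ℚ_[p]) ((p : ℝ)⁻¹ ^ n)).indicator 1 x ∂μ := by
        rw [lintegral_add_left measurable_const, setLIntegral_const,
          lintegral_const_mul _ (Measurable.tsum hm),
          lintegral_tsum fun n => (hm n).aemeasurable]
    _ ≤ ‖Real.log R‖ₑ * μ (Metric.closedBall (0 : ℚ_[p]) R) + ‖Real.log p‖ₑ *
        ∑' n : ℕ, μ (Metric.closedBall (0 : ℚ_[p]) ((p : ℝ)⁻¹ ^ n)) := by
        gcongr with n
        refine (setLIntegral_le_lintegral _ _).trans ?_
        rw [lintegral_indicator_one Metric.isClosed_closedBall.measurableSet]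
    _ < ⊤ := ENNReal.add_lt_top.2 ⟨ENNReal.mul_lt_top enorm_lt_top hball,
        ENNReal.mul_lt_top enorm_lt_top hsum⟩

theorem setIntegral_closedBall_comp_sub {y : ℚ_[p]} {R : ℝ} (hy : y ∈ Metric.closedBall 0 R)
    (g : ℚ_[p] → ℝ) :
    ∫ x in Metric.closedBall 0 R, g (x - y) ∂μ = ∫ x in Metric.closedBall 0 R, g x ∂μ := by
  have hB : MeasurableSet (Metric.closedBall (0 : ℚ_[p]) R) :=
    Metric.isClosed_closedBall.measurableSet
  rw [← integral_indicator hB, indicator_closedBall_comp_sub hy, ← integral_indicator hB]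
  exact integral_sub_right_eq_self _ y

theorem integrableOn_closedBall_comp_sub {y : ℚ_[p]} {R : ℝ} (hy : y ∈ Metric.closedBall 0 R)
    {g : ℚ_[p] → ℝ} (hg : IntegrableOn g (Metric.closedBall 0 R) μ) :
    IntegrableOn (fun x => g (x - y)) (Metric.closedBall 0 R) μ := by
  have hB : MeasurableSet (Metric.closedBall (0 : ℚ_[p]) R) :=
    Metric.isClosed_closedBall.measurableSet
  rw [← integrable_indicator_iff hB] at hg ⊢
  rw [indicator_closedBall_comp_sub hy]
  exact hg.comp_sub_right y

theorem f1conv_add_eq {θ : ℚ_[p] → ℝ} {x' : ℚ_[p]} (h : ∀ y, θ (y + x') = θ y) (x : ℚ_[p]) :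
    f1conv p μ θ (x + x') = f1conv p μ θ x := by
  unfold f1conv
  congr 1
  rw [← integral_add_right_eq_self (fun y => Real.log ‖x + x' - y‖ * θ y) x']
  simp only [h, add_sub_add_right_eq_sub]

theorem setIntegral_integral_log_norm_sub {θ : ℚ_[p] → ℝ} {R : ℝ} (hθ : Integrable θ μ)
    (hθm : Measurable θ) (hR : ∀ y, R < ‖y‖ → θ y = 0) :
    ∫ x in Metric.closedBall 0 R, ∫ y, Real.log ‖x - y‖ * θ y ∂μ ∂μ =
      (∫ x in Metric.closedBall (0 : ℚ_[p]) R, Real.log ‖x‖ ∂μ) * ∫ y, θ y ∂μ := by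
  set B := Metric.closedBall (0 : ℚ_[p]) R
  have hzero : ∀ y ∉ B, θ y = 0 := fun y hy =>
    hR y (by simpa [B, mem_closedBall_zero_iff] using hy)
  have hint : Integrable (Function.uncurry fun x y : ℚ_[p] => Real.log ‖x - y‖ * θ y)
      ((μ.restrict B).prod μ) := by
    refine (integrable_prod_iff' (Measurable.aestronglyMeasurable ?_)).2
      ⟨.of_forall fun y => ?_, ?_⟩
    · exact (Real.measurable_log.comp (measurable_fst.sub measurable_snd).norm).mul
        (hθm.comp measurable_snd)
    · by_cases hy : y ∈ B
      · exact (integrableOn_closedBall_comp_sub μ hy (integrableOn_log_norm μ R)).mul_const (θ y)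
      · simp [Function.uncurry, hzero y hy]
    · refine (hθ.norm.const_mul (∫ x in B, ‖Real.log ‖x‖‖ ∂μ)).congr (.of_forall fun y => ?_)
      simp only [Function.uncurry, norm_mul, integral_mul_const]
      by_cases hy : y ∈ B
      · rw [setIntegral_closedBall_comp_sub μ hy (fun x => ‖Real.log ‖x‖‖)]
      · simp [hzero y hy]
  rw [integral_integral_swap hint, ← integral_const_mul]
  refine integral_congr_ae (.of_forall fun y => ?_)
  simp only [integral_mul_const]
  by_cases hy : y ∈ B
  · rw [setIntegral_closedBall_comp_sub μ hy (fun x => Real.log ‖x‖)]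
  · simp [hzero y hy]

end PadicLog

theorem stmt7 {p : ℕ} [Fact p.Prime] [MeasurableSpace ℚ_[p]] [BorelSpace ℚ_[p]]
    (μ : Measure ℚ_[p]) [μ.IsAddHaarMeasure]
    (hμ : μ {x : ℚ_[p] | ‖x‖ ≤ 1} = 1)
    (θ : ℚ_[p] → ℝ) (hθ : IsTestFunction θ) (hθ0 : ∫ x, θ x ∂μ = 0) :
    IsTestFunction (f1conv p μ θ) ∧ ∫ x, f1conv p μ θ x ∂μ = 0 := by
  obtain ⟨R, hRsub⟩ := hθ.2.isCompact.isBounded.subset_closedBall 0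
  have hR : ∀ y, R < ‖y‖ → θ y = 0 := fun y hy =>
    image_eq_zero_of_notMem_tsupport fun h => by
      have := mem_closedBall_zero_iff.1 (hRsub h)
      linarith
  have hvanish : ∀ x ∉ Metric.closedBall (0 : ℚ_[p]) R, f1conv p μ θ x = 0 := fun x hx =>
    f1conv_eq_zero_of_lt_norm μ hR hθ0 (by simpa [mem_closedBall_zero_iff] using hx)
  refine ⟨⟨fun x => ?_, HasCompactSupport.intro (isCompact_closedBall 0 R) hvanish⟩, ?_⟩
  · obtain ⟨l, hl⟩ := hθ.exists_forall_add_eq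
    exact ⟨l, fun x' hx' => f1conv_add_eq μ (fun y => hl y x' hx') x⟩
  · rw [← setIntegral_eq_integral_of_forall_compl_eq_zero hvanish]
    simp only [f1conv]
    rw [integral_const_mul, setIntegral_integral_log_norm_sub μ
      (hθ.continuous.integrable_of_hasCompactSupport hθ.2) hθ.continuous.measurable hR, hθ0]
    simp
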